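/- arXiv:0706.2370 — 2 statements merged into one kernel-verified Lean document; each statement's English description precedes it below -/
import Mathlib

section
/- There exists L₀ > 0 such that for every L ≥ L₀ there exist L* ∈ [L, L + 2π/|Φ(c^{(2)}) − Φ(c^{(1)})|] and a* ∈ [0, 2π) such that f_{a*,L*} is a Misiurewicz map. -/
open Set

/-- A map `f ∈ C²(S¹, S¹)` (represented by a lift working with `2π`-periodic data)
satisfies the Misiurewicz conditions with a given set `V` containing the critical set
`C = {x | f' x = 0}`:
(A1)/(A2) expansion outside `V`, (B) critical orbits stay outside `V`,
(C1)/(C2) nondegeneracy and derivative recovery inside `V`. -/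
def IsMisiurewiczWith (f : ℝ → ℝ) (V : Set ℝ) : Prop :=
  ∃ (lam d₀ : ℝ) (M₀ : ℕ), 0 < lam ∧ 0 < M₀ ∧ 0 < d₀ ∧ d₀ ≤ 1 ∧
    -- (A1)
    (∀ (n : ℕ) (x : ℝ), M₀ ≤ n → (∀ k < n, f^[k] x ∉ V) →
      Real.exp (lam * n) ≤ |deriv (f^[n]) x|) ∧
    -- (A2)
    (∀ (n : ℕ) (x : ℝ), 0 < n → (∀ k < n, f^[k] x ∉ V) → f^[n] x ∈ V →
      d₀ * Real.exp (lam * n) ≤ |deriv (f^[n]) x|) ∧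
    -- (B)
    (∀ c : ℝ, deriv f c = 0 → ∀ n : ℕ, 0 < n → f^[n] c ∉ V) ∧
    -- (C1)
    (∀ x ∈ V, deriv (deriv f) x ≠ 0) ∧
    -- (C2)
    (∀ x ∈ V, deriv f x ≠ 0 → ∃ p : ℕ, 0 < p ∧
      (∀ j, 0 < j → j < p → f^[j] x ∉ V) ∧
      d₀⁻¹ * Real.exp (lam * p / 3) ≤ |deriv (f^[p]) x|)

/-- `f` is a Misiurewicz map: the above conditions hold for some neighborhood `V`
of the critical set. -/
def IsMisiurewicz (f : ℝ → ℝ) : Prop :=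
  ∃ V : Set ℝ, (∀ c : ℝ, deriv f c = 0 → V ∈ nhds c) ∧ IsMisiurewiczWith f V

theorem deriv_iterate_eq_prod {f : ℝ → ℝ} (hf : Differentiable ℝ f) (n : ℕ) (x : ℝ) :
    deriv (f^[n]) x = ∏ k ∈ Finset.range n, deriv f (f^[k] x) := by
  induction n with
  | zero => simp
  | succ n ih =>
    rw [Function.iterate_succ', deriv_comp _ (hf _) (hf.iterate n x), ih,
      Finset.prod_range_succ, mul_comm]

theorem pow_le_abs_deriv_iterate {f : ℝ → ℝ} (hf : Differentiable ℝ f) {D : ℝ} (hD : 0 ≤ D)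
    {n : ℕ} {x : ℝ} (h : ∀ k < n, D ≤ |deriv f (f^[k] x)|) :
    D ^ n ≤ |deriv (f^[n]) x| := by
  rw [deriv_iterate_eq_prod hf, Finset.abs_prod]
  calc D ^ n = ∏ _k ∈ Finset.range n, D := by simp
    _ ≤ _ := Finset.prod_le_prod (fun _ _ => hD) fun k hk => h k (Finset.mem_range.1 hk)

theorem mul_pow_le_abs_deriv_iterate_succ {f : ℝ → ℝ} (hf : Differentiable ℝ f) {D : ℝ}
    (hD : 0 ≤ D) {n : ℕ} {x : ℝ} (h : ∀ k, 0 < k → k < n + 1 → D ≤ |deriv f (f^[k] x)|) :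
    |deriv f x| * D ^ n ≤ |deriv (f^[n + 1]) x| := by
  rw [Function.iterate_succ, deriv_comp _ (hf.iterate n _) (hf _), abs_mul, mul_comm]
  refine mul_le_mul_of_nonneg_right (pow_le_abs_deriv_iterate hf hD fun k hk => ?_) (abs_nonneg _)
  simpa using h (k + 1) (by omega) (by omega)

theorem abs_sub_le_of_abs_deriv_le {f : ℝ → ℝ} (hf : Differentiable ℝ f) {C : ℝ}
    (h : ∀ x, |deriv f x| ≤ C) (x y : ℝ) : |f y - f x| ≤ C * |y - x| :=
  convex_univ.norm_image_sub_le_of_norm_deriv_le (fun z _ => hf z) (fun z _ => h z)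
    (mem_univ x) (mem_univ y)

theorem Function.Periodic.periodic_deriv {f : ℝ → ℝ} {T : ℝ} (hf : Function.Periodic f T) :
    Function.Periodic (deriv f) T := fun x => by
  rw [← deriv_comp_add_const, funext hf]

theorem Function.Periodic.exists_abs_le {f : ℝ → ℝ} {T : ℝ} (hf : Function.Periodic f T)
    (hT : 0 < T) (hc : Continuous f) : ∃ B > 0, ∀ x, |f x| ≤ B := by
  obtain ⟨B, hB⟩ := (isCompact_Icc (a := (0 : ℝ)) (b := T)).exists_bound_of_continuousOn
    hc.continuousOn
  refine ⟨max B 1, by positivity, fun x => ?_⟩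
  obtain ⟨y, hy, hxy⟩ := hf.exists_mem_Ico₀ hT x
  rw [hxy]
  exact (hB y ⟨hy.1, hy.2.le⟩).trans (le_max_left _ _)

theorem iterate_near_fixed_mod {f : ℝ → ℝ} {T : ℝ} (hper : Function.Periodic f T)
    {D : ℝ} (hlip : ∀ x y, |f y - f x| ≤ D * |y - x|) (hD : 0 ≤ D) {p : ℝ}
    (hp : ∃ m : ℤ, f p = p + m * T) {y E : ℝ} (hy : ∃ k : ℤ, |y - (p + k * T)| ≤ E) (n : ℕ) :
    ∃ k : ℤ, |f^[n] y - (p + k * T)| ≤ D ^ n * E := by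
  induction n with
  | zero => simpa using hy
  | succ n ih =>
    obtain ⟨k, hk⟩ := ih
    obtain ⟨m, hm⟩ := hp
    refine ⟨m, ?_⟩
    rw [← hm, ← hper.int_mul k p, Function.iterate_succ_apply', pow_succ', mul_assoc]
    exact (hlip _ _).trans (mul_le_mul_of_nonneg_left hk hD)

theorem exp_log_two_mul (n : ℕ) : Real.exp (Real.log 2 * n) = 2 ^ n := by
  rw [Real.exp_mul, Real.exp_log two_pos, Real.rpow_natCast]

/-- A strongly expanding periodic map all of whose critical points are sent (modulo the period)
to a common fixed point far from the critical set is a Misiurewicz map. -/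
theorem isMisiurewicz_of_critical_to_fixed {f : ℝ → ℝ} {T : ℝ} (hper : Function.Periodic f T)
    (hf : Differentiable ℝ f) (hf' : Differentiable ℝ (deriv f)) {p D₁ D₂ G K : ℝ}
    (hfix : ∃ m : ℤ, f p = p + m * T)
    (hcrit : ∀ c, deriv f c = 0 → ∃ k : ℤ, f c = p + k * T)
    (hD₂ : ∀ x, |deriv f x| ≤ D₂) (hG : ∀ x, |deriv (deriv f) x| ≤ G)
    (hpD : 2 * D₁ ≤ |deriv f p|) (hD₁ : 4 ≤ D₁) (hsq : 4 * D₂ ≤ D₁ ^ 2)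
    (hGK : 4 * (G * K) ≤ D₁)
    (hnear : ∀ x, |deriv f x| < 2 → deriv (deriv f) x ≠ 0 ∧
      ∃ c, deriv f c = 0 ∧ |f x - f c| ≤ K * deriv f x ^ 2) :
    IsMisiurewicz f := by
  have hD₂0 : 0 ≤ D₂ := (abs_nonneg _).trans (hD₂ 0)
  have hG0 : 0 ≤ G := (abs_nonneg _).trans (hG 0)
  have hlip := abs_sub_le_of_abs_deriv_le hf hD₂
  have hlip' := abs_sub_le_of_abs_deriv_le hf' hG
  have hper' := hper.periodic_deriv
  have hexp : ∀ (n : ℕ) (x : ℝ), (∀ k < n, f^[k] x ∉ {x | |deriv f x| < 2}) →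
      Real.exp (Real.log 2 * n) ≤ |deriv (f^[n]) x| := fun n x h => by
    rw [exp_log_two_mul]
    exact pow_le_abs_deriv_iterate hf zero_le_two fun k hk => not_lt.1 (h k hk)
  refine ⟨{x | |deriv f x| < 2}, fun c hc => ?_, Real.log 2, 1, 1, Real.log_pos one_lt_two,
    one_pos, one_pos, le_rfl, fun n x _ h => hexp n x h, fun n x _ h _ => by
      simpa using hexp n x h, fun c hc n hn => ?_, fun x hx => (hnear x hx).1,
      fun x hx hx0 => ?_⟩
  · exact (isOpen_lt hf'.continuous.abs continuous_const).mem_nhds (by simp [hc])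
  · obtain ⟨n, rfl⟩ := Nat.exists_eq_succ_of_ne_zero hn.ne'
    obtain ⟨k, hk⟩ := hcrit c hc
    obtain ⟨j, hj⟩ := iterate_near_fixed_mod hper hlip hD₂0 hfix (y := f c) (E := 0)
      ⟨k, by simp [hk]⟩ n
    have hj' : f^[n + 1] c = p + j * T := by
      rw [Function.iterate_succ_apply]
      exact sub_eq_zero.1 (abs_nonpos_iff.1 (by simpa using hj))
    rw [Nat.succ_eq_add_one, hj', mem_ofPred_eq, hper'.int_mul j p]
    linarith
  · have hfinal : ∀ n : ℕ, (∀ k, 0 < k → k < n + 1 → D₁ ≤ |deriv f (f^[k] x)|) →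
        2 ^ (n + 1) ≤ |deriv f x| * D₁ ^ n → ∃ p : ℕ, 0 < p ∧
      (∀ j, 0 < j → j < p → f^[j] x ∉ {x | |deriv f x| < 2}) ∧
      (1 : ℝ)⁻¹ * Real.exp (Real.log 2 * p / 3) ≤ |deriv (f^[p]) x| := by
      intro n hn hle
      refine ⟨n + 1, n.succ_pos, fun j h0 hj => ?_, ?_⟩
      · rw [mem_ofPred_eq]
        linarith [hn j h0 hj]
      · have h1 := mul_pow_le_abs_deriv_iterate_succ hf (by linarith) hn
        have h2 : Real.exp (Real.log 2 * (n + 1 : ℕ) / 3) ≤ 2 ^ (n + 1) := by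
          rw [← exp_log_two_mul]
          have : 0 ≤ Real.log 2 * (n + 1 : ℕ) := by positivity
          exact Real.exp_le_exp.2 (by linarith)
        rw [inv_one, one_mul]
        linarith
    have hv : 0 < |deriv f x| := abs_pos.2 hx0
    by_cases hex : ∃ n : ℕ, |deriv f (f^[n + 1] x)| < D₁
    · classical
      have hmin : ∀ k, 0 < k → k < Nat.find hex + 1 → D₁ ≤ |deriv f (f^[k] x)| := by
        intro k h0 hk
        obtain ⟨k, rfl⟩ := Nat.exists_eq_succ_of_ne_zero h0.ne'
        exact not_lt.1 (Nat.find_min hex (m := k) (by omega))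
      have hlt := Nat.find_spec hex
      refine hfinal _ hmin ?_
      generalize Nat.find hex = n at hlt
      obtain ⟨-, c, hc, hxc⟩ := hnear x hx
      obtain ⟨k, hk⟩ := hcrit c hc
      obtain ⟨j, hj⟩ := iterate_near_fixed_mod hper hlip hD₂0 hfix (y := f x)
        (E := K * deriv f x ^ 2) ⟨k, by rwa [← hk]⟩ n
      rw [← Function.iterate_succ_apply] at hj
      have h1 := hlip' (f^[n + 1] x) (p + j * T)
      rw [hper'.int_mul j p, abs_sub_comm (p + j * T)] at h1
      have h2 : D₁ ≤ G * (D₂ ^ n * (K * deriv f x ^ 2)) := by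
        have := abs_sub_abs_le_abs_sub (deriv f p) (deriv f (f^[n + 1] x))
        have := mul_le_mul_of_nonneg_left hj hG0
        simp only [Nat.succ_eq_add_one] at *
        linarith
      have h3 : (4 * D₂) ^ n ≤ (D₁ ^ 2) ^ n := pow_le_pow_left₀ (by positivity) hsq n
      have h4 : (D₁ : ℝ) * 4 ^ (n + 1) ≤ D₁ * (deriv f x ^ 2 * (D₁ ^ 2) ^ n) := by
        calc D₁ * 4 ^ (n + 1)
            ≤ G * (D₂ ^ n * (K * deriv f x ^ 2)) * 4 ^ (n + 1) := by gcongr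
          _ = 4 * (G * K) * (deriv f x ^ 2 * (4 * D₂) ^ n) := by rw [mul_pow]; ring
          _ ≤ D₁ * (deriv f x ^ 2 * (D₁ ^ 2) ^ n) := by gcongr
      have h5 := le_of_mul_le_mul_left h4 (by linarith)
      refine le_of_sq_le_sq ?_ (by positivity)
      rw [mul_pow, sq_abs, ← pow_mul, ← pow_mul, mul_comm (n + 1) 2, mul_comm n 2, pow_mul,
        pow_mul D₁]
      norm_num
      exact h5
    · push Not at hex
      obtain ⟨n, hn⟩ := pow_unbounded_of_one_lt (2 / |deriv f x|) one_lt_two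
      refine hfinal n (fun k h0 _ => ?_) ?_
      · obtain ⟨k, rfl⟩ := Nat.exists_eq_succ_of_ne_zero h0.ne'
        exact hex k
      · rw [div_lt_iff₀ hv] at hn
        calc (2 : ℝ) ^ (n + 1) = 2 ^ n * 2 := pow_succ _ _
          _ ≤ 2 ^ n * (2 ^ n * |deriv f x|) := by gcongr
          _ = |deriv f x| * 4 ^ n := by rw [show (4 : ℝ) = 2 * 2 by norm_num, mul_pow]; ring
          _ ≤ _ := by gcongr

theorem exists_quadratic_bound_near_critical {g : ℝ → ℝ} {T : ℝ} (hper : Function.Periodic g T)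
    (hT : 0 < T) (hg : ContDiff ℝ 2 g) (hnd : ∀ x, deriv g x = 0 → deriv (deriv g) x ≠ 0) :
    ∃ η > 0, ∃ K > 0, ∀ x, |deriv g x| < η → deriv (deriv g) x ≠ 0 ∧
      ∃ c, deriv g c = 0 ∧ |g x - g c| ≤ K * deriv g x ^ 2 := by
  have hg1 : ContDiff ℝ 1 (deriv g) := (contDiff_succ_iff_deriv (n := 1)).1 hg |>.2.2
  have hg' : Differentiable ℝ g := hg.differentiable (by norm_num)
  have hg'' : Differentiable ℝ (deriv g) := hg1.differentiable (by norm_num)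
  have hc2 : Continuous (deriv (deriv g)) := hg1.continuous_deriv (by norm_num)
  obtain ⟨B, hB0, hB⟩ := hper.periodic_deriv.periodic_deriv.exists_abs_le hT hc2
  have hcover : ∃ η > 0, ∃ K > 0, ∀ x ∈ Icc 0 T, |deriv g x| < η → deriv (deriv g) x ≠ 0 ∧
      ∃ c, deriv g c = 0 ∧ |g x - g c| ≤ K * deriv g x ^ 2 := by
    refine isCompact_Icc.induction_on (p := fun s => ∃ η > 0, ∃ K > 0, ∀ x ∈ s,
      |deriv g x| < η → deriv (deriv g) x ≠ 0 ∧
      ∃ c, deriv g c = 0 ∧ |g x - g c| ≤ K * deriv g x ^ 2)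
      ⟨1, one_pos, 1, one_pos, by simp⟩ ?_ ?_ ?_
    · rintro s t hst ⟨η, hη, K, hK, h⟩
      exact ⟨η, hη, K, hK, fun x hx => h x (hst hx)⟩
    · rintro s t ⟨η₁, hη₁, K₁, hK₁, h₁⟩ ⟨η₂, hη₂, K₂, hK₂, h₂⟩
      refine ⟨min η₁ η₂, lt_min hη₁ hη₂, max K₁ K₂, lt_max_of_lt_left hK₁, ?_⟩
      rintro x (hx | hx) hlt
      · obtain ⟨h, c, hc, hle⟩ := h₁ x hx (hlt.trans_le (min_le_left _ _))
        exact ⟨h, c, hc, hle.trans (by gcongr; exact le_max_left _ _)⟩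
      · obtain ⟨h, c, hc, hle⟩ := h₂ x hx (hlt.trans_le (min_le_right _ _))
        exact ⟨h, c, hc, hle.trans (by gcongr; exact le_max_right _ _)⟩
    · intro x₀ _
      by_cases h0 : deriv g x₀ = 0
      · set m := |deriv (deriv g) x₀| / 2 with hm
        have hm0 : 0 < m := by have := abs_pos.2 (hnd x₀ h0); positivity
        have hev : ∀ᶠ x in nhds x₀, |deriv (deriv g) x - deriv (deriv g) x₀| < m :=
          Metric.continuousAt_iff'.1 hc2.continuousAt m hm0
        obtain ⟨r, hr, hball⟩ := Metric.eventually_nhds_iff_ball.1 hev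
        refine ⟨Metric.ball x₀ r, mem_nhdsWithin_of_mem_nhds (Metric.ball_mem_nhds _ hr),
          1, one_pos, B / m ^ 2, by positivity, fun x hx _ => ⟨fun hx0 => ?_, x₀, h0, ?_⟩⟩
        · have := hball x hx
          rw [hx0, zero_sub, abs_neg] at this
          linarith
        · have hconv := convex_ball x₀ r
          have hx₀ : x₀ ∈ Metric.ball x₀ r := Metric.mem_ball_self hr
          have hlow : m * |x - x₀| ≤ |deriv g x| := by
            have h1 : |(deriv g x - deriv (deriv g) x₀ * x) -
                (deriv g x₀ - deriv (deriv g) x₀ * x₀)| ≤ m * |x - x₀| := by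
              refine hconv.norm_image_sub_le_of_norm_hasDerivWithin_le
                (f := fun y => deriv g y - deriv (deriv g) x₀ * y)
                (f' := fun y => deriv (deriv g) y - deriv (deriv g) x₀ * 1)
                (fun y _ => ((hg'' y).hasDerivAt.sub
                  ((hasDerivAt_id y).const_mul _)).hasDerivWithinAt) (fun y hy => ?_) hx₀ hx
              rw [mul_one]
              exact (hball y hy).le
            have h2 : |deriv (deriv g) x₀| * |x - x₀| ≤ |deriv g x| + m * |x - x₀| := by
              rw [← abs_mul]
              rw [h0, abs_le] at h1
              refine abs_le.2 ⟨?_, ?_⟩ <;>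
                linarith [le_abs_self (deriv g x), neg_abs_le (deriv g x)]
            rw [show |deriv (deriv g) x₀| = m + m by rw [hm]; ring] at h2
            linarith
          have hup : |g x - g x₀| ≤ B * |x - x₀| * |x - x₀| := by
            refine (convex_closedBall x₀ |x - x₀|).norm_image_sub_le_of_norm_deriv_le
              (fun y _ => hg' y) (fun y hy => ?_) (Metric.mem_closedBall_self (abs_nonneg _))
              (Metric.mem_closedBall.2 le_rfl)
            have := abs_sub_le_of_abs_deriv_le hg'' hB x₀ y
            rw [h0, sub_zero] at this
            exact this.trans (mul_le_mul_of_nonneg_left hy hB0.le)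
          calc |g x - g x₀| ≤ B / m ^ 2 * (m * |x - x₀|) ^ 2 := by
                refine hup.trans_eq ?_
                field_simp
            _ ≤ B / m ^ 2 * |deriv g x| ^ 2 := by gcongr
            _ = _ := by rw [sq_abs]
      · have hpos := abs_pos.2 h0
        refine ⟨{x | |deriv g x₀| / 2 < |deriv g x|}, mem_nhdsWithin_of_mem_nhds
          ((isOpen_lt continuous_const hg1.continuous.abs).mem_nhds (half_lt_self hpos)),
          |deriv g x₀| / 2, half_pos hpos, 1, one_pos, fun x hx hlt => (lt_asymm hx hlt).elim⟩
  obtain ⟨η, hη, K, hK, h⟩ := hcover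
  refine ⟨η, hη, K, hK, fun x hx => ?_⟩
  obtain ⟨k, hk, -⟩ := existsUnique_add_zsmul_mem_Ico hT x 0
  have e0 := hper.zsmul k x
  have e1 := hper.periodic_deriv.zsmul k x
  have e2 := hper.periodic_deriv.periodic_deriv.zsmul k x
  rw [zero_add] at hk
  have := h (x + k • T) ⟨hk.1, hk.2.le⟩
  rw [e0, e1, e2] at this
  exact this hx

theorem exists_int_mul_eq {g : ℝ → ℝ} (hg : Differentiable ℝ g)
    (hg' : Differentiable ℝ (deriv g)) {B A q : ℝ} (hB0 : 0 < B)
    (hB : ∀ x, |deriv (deriv g) x| ≤ B) (hA : 0 < A) (hq : 4 * A ≤ |deriv g q|) {T : ℝ}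
    (hT : 0 < T) {L : ℝ} (hL : T * B ≤ L * (4 * A ^ 2)) (v : ℝ) :
    ∃ p, 2 * A ≤ |deriv g p| ∧ ∃ m : ℤ, L * (g p - v) = m * T := by
  have hL0 : 0 < L := by
    have : 0 < L * (4 * A ^ 2) := (mul_pos hT hB0).trans_le hL
    exact pos_of_mul_pos_left this (by positivity)
  set r := 2 * A / B with hr
  have hr0 : 0 < r := by positivity
  have hfar : ∀ y ∈ Icc q (q + r), 2 * A ≤ |deriv g y| := by
    intro y hy
    have h1 := abs_sub_le_of_abs_deriv_le hg' hB y q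
    have h2 : |q - y| ≤ r := abs_le.2 ⟨by linarith [hy.2], by linarith [hy.1]⟩
    have h3 : B * |q - y| ≤ 2 * A := by
      calc B * |q - y| ≤ B * r := by gcongr
        _ = 2 * A := by rw [hr]; field_simp
    linarith [abs_sub_abs_le_abs_sub (deriv g q) (deriv g y)]
  obtain ⟨ξ, hξ, hξe⟩ := exists_deriv_eq_slope g (a := q) (b := q + r) (by linarith)
    hg.continuous.continuousOn hg.differentiableOn
  have hinc : T ≤ |L * (g (q + r) - v) - L * (g q - v)| := by
    have h1 := hfar ξ ⟨hξ.1.le, hξ.2.le⟩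
    rw [hξe, add_sub_cancel_left, abs_div, abs_of_pos hr0, le_div_iff₀ hr0] at h1
    rw [← mul_sub, sub_sub_sub_cancel_right, abs_mul, abs_of_pos hL0]
    calc T ≤ L * (2 * A * r) := by
          rw [hr]
          field_simp
          linarith
      _ ≤ _ := by gcongr
  have hint : ∀ a b : ℝ, a + T ≤ b → ∃ m : ℤ, (m : ℝ) * T ∈ Icc a b := by
    intro a b hab
    refine ⟨⌈a / T⌉, ?_, ?_⟩
    · exact (div_le_iff₀ hT).1 (Int.le_ceil _)
    · have := mul_lt_mul_of_pos_right (Int.ceil_lt_add_one (a / T)) hT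
      rw [add_mul, div_mul_cancel₀ _ hT.ne'] at this
      linarith
  have hcont : ContinuousOn (fun y => L * (g y - v)) (uIcc q (q + r)) :=
    (continuous_const.mul (hg.continuous.sub continuous_const)).continuousOn
  have hm : ∃ m : ℤ, (m : ℝ) * T ∈ uIcc (L * (g q - v)) (L * (g (q + r) - v)) := by
    rcases le_abs.1 hinc with h | h
    · obtain ⟨m, hm⟩ := hint (L * (g q - v)) (L * (g (q + r) - v)) (by linarith)
      exact ⟨m, Icc_subset_uIcc hm⟩
    · obtain ⟨m, hm⟩ := hint (L * (g (q + r) - v)) (L * (g q - v)) (by linarith)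
      exact ⟨m, Icc_subset_uIcc' hm⟩
  obtain ⟨m, hm⟩ := hm
  obtain ⟨p, hp, hpm⟩ := intermediate_value_uIcc hcont hm
  rw [uIcc_of_le (by linarith)] at hp
  exact ⟨p, hfar p hp, m, hpm⟩

/-- Theorem: existence of Misiurewicz pairs.
Let `Φ : S¹ → ℝ` (a `2π`-periodic `C³` function on `ℝ`) have exactly two
nondegenerate critical points `c1 ≠ c2` (mod `2π`) with `Φ c1 ≠ Φ c2`, and fix `ζ`.
For `f_{a,L}(θ) = ζ + L·Φ(θ) + a`: there is `L₀ > 0` such that for every `L ≥ L₀`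
there are `L* ∈ [L, L + 2π/|Φ c2 − Φ c1|]` and `a* ∈ [0, 2π)` with
`f_{a*,L*}` a Misiurewicz map. -/
theorem stmt_2
    (Φ : ℝ → ℝ) (hΦ : ContDiff ℝ 3 Φ)
    (hper : Function.Periodic Φ (2 * Real.pi))
    (c1 c2 : ℝ) (hc1 : c1 ∈ Ico 0 (2 * Real.pi)) (hc2 : c2 ∈ Ico 0 (2 * Real.pi))
    (hne : c1 ≠ c2)
    (hcrit1 : deriv Φ c1 = 0) (hcrit2 : deriv Φ c2 = 0)
    (hnd1 : deriv (deriv Φ) c1 ≠ 0) (hnd2 : deriv (deriv Φ) c2 ≠ 0)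
    (honly : ∀ x : ℝ, deriv Φ x = 0 →
      (∃ k : ℤ, x = c1 + 2 * Real.pi * k) ∨ (∃ k : ℤ, x = c2 + 2 * Real.pi * k))
    (hval : Φ c1 ≠ Φ c2)
    (ζ : ℝ) :
    ∃ L₀ > (0 : ℝ), ∀ L ≥ L₀,
      ∃ Lstar ∈ Icc L (L + 2 * Real.pi / |Φ c2 - Φ c1|),
      ∃ astar ∈ Ico 0 (2 * Real.pi),
        IsMisiurewicz (fun θ => ζ + Lstar * Φ θ + astar) := by
  have hT : 0 < 2 * Real.pi := Real.two_pi_pos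
  have hΦ1 : ContDiff ℝ 2 (deriv Φ) := (contDiff_succ_iff_deriv (n := 2)).1 hΦ |>.2.2
  have hd : Differentiable ℝ Φ := hΦ.differentiable (by norm_num)
  have hd' : Differentiable ℝ (deriv Φ) := hΦ1.differentiable (by norm_num)
  have hper' := hper.periodic_deriv
  obtain ⟨B₁, hB₁0, hB₁⟩ := hper'.exists_abs_le hT hΦ1.continuous
  obtain ⟨B₂, hB₂0, hB₂⟩ := hper'.periodic_deriv.exists_abs_le hT
    (hΦ1.continuous_deriv (by norm_num))
  have hnd : ∀ x, deriv Φ x = 0 → deriv (deriv Φ) x ≠ 0 := by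
    intro x hx
    rcases honly x hx with ⟨k, rfl⟩ | ⟨k, rfl⟩
    · rwa [mul_comm, hper'.periodic_deriv.int_mul k c1]
    · rwa [mul_comm, hper'.periodic_deriv.int_mul k c2]
  obtain ⟨η, hη, K, hK, hnear⟩ := exists_quadratic_bound_near_critical hper hT
    (hΦ.of_le (by norm_num)) hnd
  obtain ⟨q, hq⟩ : ∃ q, deriv Φ q ≠ 0 := by
    by_contra! h
    exact hval (is_const_of_deriv_eq_zero hd h c1 c2)
  set A := |deriv Φ q| / 4 with hA
  have hA0 : 0 < A := by have := abs_pos.2 hq; positivity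
  have hΔ : 0 < |Φ c2 - Φ c1| := abs_pos.2 (sub_ne_zero.2 hval.symm)
  have hlarge : ∀ a b : ℝ, 0 < a → ∀ᶠ L : ℝ in Filter.atTop, b ≤ L * a := fun a b ha =>
    (Filter.tendsto_id.atTop_mul_const ha).eventually_ge_atTop b
  obtain ⟨L₁, hL₁⟩ := Filter.eventually_atTop.1 ((hlarge η 2 hη).and <| (hlarge A 4 hA0).and <|
    (hlarge (4 * A ^ 2) (2 * Real.pi * B₂) (by positivity)).and <|
    (hlarge (A ^ 2) (4 * B₁) (by positivity)).and (hlarge A (4 * (B₂ * K)) hA0))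
  refine ⟨max L₁ 1, by positivity, fun L hL => ?_⟩
  obtain ⟨k, hLk, hkL⟩ : ∃ k : ℤ, L ≤ k * (2 * Real.pi / |Φ c2 - Φ c1|) ∧
      k * (2 * Real.pi / |Φ c2 - Φ c1|) ≤ L + 2 * Real.pi / |Φ c2 - Φ c1| := by
    have hτ : 0 < 2 * Real.pi / |Φ c2 - Φ c1| := by positivity
    refine ⟨⌈L / (2 * Real.pi / |Φ c2 - Φ c1|)⌉, (div_le_iff₀ hτ).1 (Int.le_ceil _), ?_⟩
    have := mul_lt_mul_of_pos_right (Int.ceil_lt_add_one (L / (2 * Real.pi / |Φ c2 - Φ c1|))) hτ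
    rw [add_mul, div_mul_cancel₀ _ hτ.ne'] at this
    linarith
  generalize hM : k * (2 * Real.pi / |Φ c2 - Φ c1|) = M at hLk hkL
  have hM1 : 1 ≤ M := (le_max_right L₁ 1).trans (hL.trans hLk)
  have hM0 : 0 < M := by linarith
  obtain ⟨hMη, hM4, hMT, hMsq, hMK⟩ := hL₁ M ((le_max_left L₁ 1).trans (hL.trans hLk))
  obtain ⟨p, hpA, m, hpm⟩ := exists_int_mul_eq hd hd' hB₂0 hB₂ hA0 (q := q) (by linarith) hT hMT
    (Φ c1)
  have hc12 : ∃ j : ℤ, M * (Φ c2 - Φ c1) = j * (2 * Real.pi) := by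
    have h1 : M * |Φ c2 - Φ c1| = k * (2 * Real.pi) := by
      rw [← hM]
      field_simp
    rcases abs_choice (Φ c2 - Φ c1) with h | h
    · exact ⟨k, by rw [← h, h1]⟩
    · exact ⟨-k, by rw [h] at h1; push_cast; linarith⟩
  obtain ⟨j, hj⟩ := hc12
  have hamod := toIcoMod_add_toIcoDiv_zsmul hT 0 (p - ζ - M * Φ c1)
  have hamem := toIcoMod_mem_Ico' hT (p - ζ - M * Φ c1)
  generalize toIcoMod hT 0 (p - ζ - M * Φ c1) = a at hamod hamem
  generalize toIcoDiv hT 0 (p - ζ - M * Φ c1) = l at hamod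
  rw [zsmul_eq_mul] at hamod
  refine ⟨M, ⟨hLk, hkL⟩, a, hamem, ?_⟩
  have hder : deriv (fun θ => ζ + M * Φ θ + a) = fun θ => M * deriv Φ θ := by
    funext θ
    exact (((hd θ).hasDerivAt.const_mul M).const_add ζ |>.add_const a).deriv
  have hder2 : deriv (fun θ => M * deriv Φ θ) = fun θ => M * deriv (deriv Φ) θ := by
    funext θ
    exact ((hd' θ).hasDerivAt.const_mul M).deriv
  have habs : ∀ y, |M * y| = M * |y| := fun y => by rw [abs_mul, abs_of_pos hM0]
  refine isMisiurewicz_of_critical_to_fixed (T := 2 * Real.pi) (p := p) (D₁ := M * A)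
    (D₂ := M * B₁) (G := M * B₂) (K := K / M) (fun θ => by simp only [hper θ])
    (((hd.const_mul M).const_add ζ).add_const a) ?_ ⟨m - l, ?_⟩ ?_ ?_ ?_ ?_ hM4 ?_ ?_ ?_
  · rw [hder]
    exact hd'.const_mul M
  · push_cast
    linarith
  · intro c hc
    rw [hder] at hc
    rcases honly c ((mul_eq_zero_iff_left hM0.ne').1 hc) with ⟨i, rfl⟩ | ⟨i, rfl⟩
    · refine ⟨-l, ?_⟩
      rw [mul_comm (2 * Real.pi), hper.int_mul i c1]
      push_cast
      linarith
    · refine ⟨j - l, ?_⟩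
      rw [mul_comm (2 * Real.pi), hper.int_mul i c2]
      push_cast
      linarith
  · intro x
    rw [hder, habs]
    exact mul_le_mul_of_nonneg_left (hB₁ x) hM0.le
  · intro x
    rw [hder, hder2, habs]
    exact mul_le_mul_of_nonneg_left (hB₂ x) hM0.le
  · rw [hder, habs]
    linarith [mul_le_mul_of_nonneg_left hpA hM0.le]
  · linarith [mul_le_mul_of_nonneg_left hMsq hM0.le]
  · rw [show M * B₂ * (K / M) = B₂ * K by field_simp]
    exact hMK
  · intro x hx
    simp only [hder, hder2] at hx ⊢
    rw [habs] at hx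
    obtain ⟨h2, c, hc, hle⟩ := hnear x (lt_of_mul_lt_mul_left (hx.trans_le hMη) hM0.le)
    refine ⟨mul_ne_zero hM0.ne' h2, c, by rw [hc, mul_zero], ?_⟩
    rw [show ζ + M * Φ x + a - (ζ + M * Φ c + a) = M * (Φ x - Φ c) by ring, habs]
    calc M * |Φ x - Φ c| ≤ M * (K * deriv Φ x ^ 2) := by gcongr
      _ = K / M * (M * deriv Φ x) ^ 2 := by field_simp
end

section
/- For each i ∈ {1, 2, 3} there exist a constant C > 0 and N ∈ ℕ such that for all n ≥ N and all a ∈ [0, 2π), the i-th derivative of a ↦ μ(a, n) satisfies |∂_a^{(i)} μ(a, n)| ≤ C · μ_n^{i+1} / (log(μ_n^{−1}))^{i}. -/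
open Set Filter

/-- The function `ξ(μ) = (ω + γ(μ)μ) τ(μ) + (β(μ)/2) L² μ^{2ρ₂−1}`, with
`τ(μ) = μ⁻¹ log z̃(μ)` and `z̃(μ) = L μ^{ρ₂−ρ₁} − K₄`. -/
noncomputable def xiFn (ω K₄ L ρ₁ ρ₂ : ℝ) (γ β : ℝ → ℝ) (μ : ℝ) : ℝ :=
  (ω + γ μ * μ) * (Real.log (L * μ ^ (ρ₂ - ρ₁) - K₄) / μ)
    + (β μ / 2) * L ^ 2 * μ ^ (2 * ρ₂ - 1)


section SymbolBounds

open Asymptotics Topology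

/-- `SymbolBound k f w` says that near `0` from the right, the derivatives `f⁽ʲ⁾` with `j ≤ k`
exist and are `O(w x / x ^ j)`. -/
def SymbolBound : ℕ → (ℝ → ℝ) → (ℝ → ℝ) → Prop
  | 0, f, w => f =O[𝓝[>] 0] w
  | k + 1, f, w => f =O[𝓝[>] 0] w ∧ (∀ᶠ x in 𝓝[>] (0 : ℝ), DifferentiableAt ℝ f x) ∧
      SymbolBound k (deriv f) (fun x => w x / x)

lemma eventually_nhdsGT_nhds {p : ℝ → Prop} {a : ℝ} (h : ∀ᶠ x in 𝓝[>] a, p x) :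
    ∀ᶠ x in 𝓝[>] a, ∀ᶠ y in 𝓝 x, p y := by
  filter_upwards [eventually_eventually_nhdsWithin.2 h, self_mem_nhdsWithin] with x hx hx0
  rwa [isOpen_Ioi.nhdsWithin_eq hx0] at hx

lemma eventuallyEq_deriv_nhdsGT {f g : ℝ → ℝ} {a : ℝ} (h : f =ᶠ[𝓝[>] a] g) :
    deriv f =ᶠ[𝓝[>] a] deriv g := by
  filter_upwards [eventually_nhdsGT_nhds h] with x hx
  exact EventuallyEq.deriv_eq hx

namespace SymbolBound

variable {k : ℕ} {f g w v : ℝ → ℝ}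

lemma isBigO (h : SymbolBound k f w) : f =O[𝓝[>] 0] w := by
  cases k with
  | zero => exact h
  | succ k => exact h.1

lemma congr (h : SymbolBound k f w) (hfg : f =ᶠ[𝓝[>] 0] g) : SymbolBound k g w := by
  induction k generalizing f g w with
  | zero => exact h.congr' hfg EventuallyEq.rfl
  | succ k ih =>
    refine ⟨h.1.congr' hfg EventuallyEq.rfl, ?_, ih h.2.2 (eventuallyEq_deriv_nhdsGT hfg)⟩
    filter_upwards [eventually_nhdsGT_nhds hfg, h.2.1] with x hx hd
    exact hd.congr_of_eventuallyEq (EventuallyEq.symm hx)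

lemma weight_mono (h : SymbolBound k f w) (hwv : w =O[𝓝[>] 0] v) : SymbolBound k f v := by
  induction k generalizing f w v with
  | zero => exact h.trans hwv
  | succ k ih =>
    refine ⟨h.1.trans hwv, h.2.1, ih h.2.2 ?_⟩
    simpa only [div_eq_mul_inv] using hwv.mul (isBigO_refl (fun x : ℝ => x⁻¹) _)

lemma of_succ (h : SymbolBound (k + 1) f w) : SymbolBound k f w := by
  induction k generalizing f w with
  | zero => exact h.1
  | succ k ih => exact ⟨h.1, h.2.1, ih h.2.2⟩

lemma add (hf : SymbolBound k f w) (hg : SymbolBound k g w) :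
    SymbolBound k (fun x => f x + g x) w := by
  induction k generalizing f g w with
  | zero => exact IsBigO.add hf hg
  | succ k ih =>
    refine ⟨hf.1.add hg.1, ?_, (ih hf.2.2 hg.2.2).congr ?_⟩
    · filter_upwards [hf.2.1, hg.2.1] with x h1 h2 using h1.add h2
    · filter_upwards [hf.2.1, hg.2.1] with x h1 h2 using (deriv_fun_add h1 h2).symm

lemma mul (hf : SymbolBound k f w) (hg : SymbolBound k g v) :
    SymbolBound k (fun x => f x * g x) (fun x => w x * v x) := by
  induction k generalizing f g w v with
  | zero => exact IsBigO.mul hf hg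
  | succ k ih =>
    refine ⟨hf.1.mul hg.1, ?_, ?_⟩
    · filter_upwards [hf.2.1, hg.2.1] with x h1 h2 using h1.mul h2
    · have h1 := ih hf.2.2 hg.of_succ
      have h2 := ih hf.of_succ hg.2.2
      have e1 : (fun x => w x / x * v x) = fun x => w x * v x / x := by funext x; ring
      have e2 : (fun x => w x * (v x / x)) = fun x => w x * v x / x := by funext x; ring
      rw [e1] at h1
      rw [e2] at h2
      refine (h1.add h2).congr ?_
      filter_upwards [hf.2.1, hg.2.1] with x h1 h2 using (deriv_fun_mul h1 h2).symm

lemma neg (hf : SymbolBound k f w) : SymbolBound k (fun x => -f x) w := by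
  induction k generalizing f w with
  | zero => exact hf.neg_left
  | succ k ih =>
    refine ⟨hf.1.neg_left, ?_, (ih hf.2.2).congr ?_⟩
    · filter_upwards [hf.2.1] with x h1 using h1.neg
    · exact Eventually.of_forall fun x => (deriv.fun_neg).symm

lemma inv (hf : SymbolBound k f w) (hwf : w =O[𝓝[>] 0] f) (hw : ∀ᶠ x in 𝓝[>] 0, w x ≠ 0) :
    SymbolBound k (fun x => (f x)⁻¹) (fun x => (w x)⁻¹) := by
  have hf0 : ∀ᶠ x in 𝓝[>] 0, f x ≠ 0 := by
    filter_upwards [hwf.eq_zero_imp, hw] with x h1 h2 h3 using h2 (h1 h3)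
  have hO : (fun x => (f x)⁻¹) =O[𝓝[>] 0] fun x => (w x)⁻¹ :=
    hwf.inv_rev (hw.mono fun x h1 h2 => absurd h2 h1)
  induction k with
  | zero => exact hO
  | succ k ih =>
    have hi := ih hf.of_succ
    refine ⟨hO, ?_, ?_⟩
    · filter_upwards [hf.2.1, hf0] with x h1 h2 using h1.inv h2
    · refine (((hf.2.2.mul (hi.mul hi)).neg).congr ?_).weight_mono ?_
      · filter_upwards [hf.2.1, hf0] with x h1 h2
        rw [deriv_fun_inv'' h1 h2]
        field_simp
      · refine EventuallyEq.isBigO ?_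
        filter_upwards [hw] with x h1
        field_simp

lemma of_contDiffAt (hf : ContDiffAt ℝ (⊤ : ℕ∞) f 0) : SymbolBound k f (fun _ => 1) := by
  induction k generalizing f with
  | zero => exact (hf.continuousAt.isBigO_one ℝ).mono nhdsWithin_le_nhds
  | succ k ih =>
    refine ⟨(hf.continuousAt.isBigO_one ℝ).mono nhdsWithin_le_nhds, ?_, ?_⟩
    · have h1 : ContDiffAt ℝ 1 f 0 := hf.of_le (by exact_mod_cast le_top)
      filter_upwards [nhdsWithin_le_nhds (h1.eventually (by simp))] with x hx
      exact hx.differentiableAt (by simp)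
    · refine (ih (hf.derivWithin (by simp))).weight_mono ?_
      refine IsBigO.of_bound 1 ?_
      filter_upwards [Ioo_mem_nhdsGT (zero_lt_one' ℝ)] with x hx
      have := one_le_one_div hx.1 hx.2.le
      rw [norm_one, Real.norm_of_nonneg (by linarith)]
      linarith

lemma const (c : ℝ) : SymbolBound k (fun _ => c) (fun _ => 1) :=
  of_contDiffAt contDiffAt_const

lemma const_mul (c : ℝ) (hf : SymbolBound k f w) : SymbolBound k (fun x => c * f x) w := by
  simpa using (const c).mul hf

lemma rpow (p : ℝ) : SymbolBound k (fun x => x ^ p) (fun x => x ^ p) := by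
  induction k generalizing p with
  | zero => exact isBigO_refl _ _
  | succ k ih =>
    refine ⟨isBigO_refl _ _, ?_, ?_⟩
    · filter_upwards [self_mem_nhdsWithin] with x hx
      exact (Real.hasDerivAt_rpow_const (Or.inl (ne_of_gt hx))).differentiableAt
    · refine (((ih (p - 1)).const_mul p).congr ?_).weight_mono ?_
      · filter_upwards [self_mem_nhdsWithin] with x hx
        exact ((Real.hasDerivAt_rpow_const (Or.inl (ne_of_gt hx))).deriv).symm
      · refine EventuallyEq.isBigO ?_
        filter_upwards [self_mem_nhdsWithin] with x hx
        exact Real.rpow_sub_one (ne_of_gt hx) p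

end SymbolBound

lemma eventually_le_neg_log_nhdsGT (c : ℝ) : ∀ᶠ x in 𝓝[>] (0 : ℝ), c ≤ -Real.log x :=
  (tendsto_neg_atBot_atTop.comp Real.tendsto_log_nhdsGT_zero).eventually_ge_atTop c

lemma one_isBigO_neg_log : (fun _ => (1 : ℝ)) =O[𝓝[>] 0] fun x => -Real.log x := by
  refine IsBigO.of_bound 1 ?_
  filter_upwards [eventually_le_neg_log_nhdsGT 1] with x hx
  rw [norm_one, Real.norm_of_nonneg (by linarith)]
  linarith

lemma one_isLittleO_neg_log : (fun _ => (1 : ℝ)) =o[𝓝[>] 0] fun x => -Real.log x := by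
  rw [isLittleO_one_left_iff]
  exact tendsto_norm_atTop_atTop.comp
    (tendsto_neg_atBot_atTop.comp Real.tendsto_log_nhdsGT_zero)

lemma rpow_isBigO_rpow_nhdsGT {p q : ℝ} (h : q ≤ p) :
    (fun x : ℝ => x ^ p) =O[𝓝[>] 0] fun x => x ^ q := by
  refine IsBigO.of_bound 1 ?_
  filter_upwards [Ioo_mem_nhdsGT (zero_lt_one' ℝ)] with x hx
  rw [Real.norm_of_nonneg (Real.rpow_nonneg hx.1.le _),
    Real.norm_of_nonneg (Real.rpow_nonneg hx.1.le _), one_mul]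
  exact Real.rpow_le_rpow_of_exponent_ge hx.1 hx.2.le h

section LogShiftedPower

variable {L K p : ℝ}

lemma eventually_half_mul_rpow_le (hL : 0 < L) (hp : p < 0) :
    ∀ᶠ x in 𝓝[>] (0 : ℝ), L / 2 * x ^ p ≤ L * x ^ p - K := by
  filter_upwards [(tendsto_rpow_neg_nhdsGT_zero hp).eventually_ge_atTop (K / (L / 2))] with x hx
  rw [div_le_iff₀ (by positivity)] at hx
  linarith

lemma symbolBound_shifted_rpow (hp : p < 0) (k : ℕ) :
    SymbolBound k (fun x => L * x ^ p - K) (fun x => x ^ p) := by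
  have h1 : SymbolBound k (fun _ => -K) (fun x => x ^ p) :=
    (SymbolBound.const (-K)).weight_mono (by simpa using rpow_isBigO_rpow_nhdsGT hp.le)
  simpa [sub_eq_add_neg] using ((SymbolBound.rpow p).const_mul L).add h1

lemma symbolBound_deriv_log_shifted_rpow (hL : 0 < L) (hp : p < 0) (k : ℕ) :
    SymbolBound k (deriv fun x => Real.log (L * x ^ p - K)) (fun x => x⁻¹) := by
  have hz := symbolBound_shifted_rpow (L := L) (K := K) hp (k + 1)
  have hO : (fun x : ℝ => x ^ p) =O[𝓝[>] 0] fun x => L * x ^ p - K := by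
    refine IsBigO.of_bound (2 / L) ?_
    filter_upwards [eventually_half_mul_rpow_le (K := K) hL hp, self_mem_nhdsWithin] with x h1 hx
    have h2 : 0 < x ^ p := Real.rpow_pos_of_pos hx _
    rw [Real.norm_of_nonneg h2.le, Real.norm_of_nonneg (le_trans (by positivity) h1)]
    calc x ^ p = 2 / L * (L / 2 * x ^ p) := by field_simp
      _ ≤ _ := by gcongr
  have hw : ∀ᶠ x in 𝓝[>] (0 : ℝ), x ^ p ≠ 0 := by
    filter_upwards [self_mem_nhdsWithin] with x hx using (Real.rpow_pos_of_pos hx _).ne'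
  refine ((hz.2.2.mul (hz.of_succ.inv hO hw)).congr ?_).weight_mono (EventuallyEq.isBigO ?_)
  · filter_upwards [eventually_half_mul_rpow_le (K := K) hL hp, self_mem_nhdsWithin, hz.2.1]
      with x h1 hx hd
    have h2 : 0 < x ^ p := Real.rpow_pos_of_pos hx _
    have h3 : L * x ^ p - K ≠ 0 := (lt_of_lt_of_le (by positivity) h1).ne'
    rw [deriv.log hd h3, div_eq_mul_inv]
  · filter_upwards [hw] with x h1
    field_simp

lemma eventually_le_log_shifted_rpow (hL : 0 < L) (hp : p < 0) :
    ∀ᶠ x in 𝓝[>] (0 : ℝ), -p / 2 * -Real.log x ≤ Real.log (L * x ^ p - K) := by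
  filter_upwards [eventually_half_mul_rpow_le (K := K) hL hp, self_mem_nhdsWithin,
    eventually_le_neg_log_nhdsGT (-Real.log (L / 2) / (-p / 2))] with x h1 hx h3
  have h2 : 0 < x ^ p := Real.rpow_pos_of_pos hx _
  rw [div_le_iff₀ (by linarith)] at h3
  have h4 := Real.log_le_log (by positivity) h1
  rw [Real.log_mul (by positivity) h2.ne', Real.log_rpow hx] at h4
  linarith

lemma symbolBound_log_shifted_rpow (hL : 0 < L) (hK : 0 ≤ K) (hp : p < 0) (k : ℕ) :
    SymbolBound k (fun x => Real.log (L * x ^ p - K)) (fun x => -Real.log x) := by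
  have h0 : (fun x => Real.log (L * x ^ p - K)) =O[𝓝[>] 0] fun x => -Real.log x := by
    refine IsBigO.of_bound (|Real.log L| + -p) ?_
    filter_upwards [eventually_half_mul_rpow_le (K := K) hL hp, self_mem_nhdsWithin,
      eventually_le_log_shifted_rpow (K := K) hL hp, eventually_le_neg_log_nhdsGT 1]
      with x h1 hx h3 h4
    have h2 : 0 < x ^ p := Real.rpow_pos_of_pos hx _
    have h5 : 0 ≤ Real.log (L * x ^ p - K) := le_trans (mul_nonneg (by linarith) (by linarith)) h3
    have h6 : Real.log (L * x ^ p - K) ≤ Real.log (L * x ^ p) :=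
      Real.log_le_log (lt_of_lt_of_le (by positivity) h1) (by linarith)
    rw [Real.log_mul (by positivity) h2.ne', Real.log_rpow hx] at h6
    rw [Real.norm_of_nonneg h5, Real.norm_of_nonneg (by linarith)]
    have h7 := le_mul_of_one_le_right (abs_nonneg (Real.log L)) h4
    nlinarith [le_abs_self (Real.log L)]
  cases k with
  | zero => exact h0
  | succ k =>
    refine ⟨h0, ?_, (symbolBound_deriv_log_shifted_rpow hL hp k).weight_mono ?_⟩
    · filter_upwards [eventually_half_mul_rpow_le (K := K) hL hp, self_mem_nhdsWithin,
        (symbolBound_shifted_rpow (L := L) (K := K) hp 1).2.1] with x h1 hx hd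
      have h2 : 0 < x ^ p := Real.rpow_pos_of_pos hx _
      exact hd.log (lt_of_lt_of_le (by positivity) h1).ne'
    · simpa [div_eq_mul_inv] using one_isBigO_neg_log.mul (isBigO_refl (fun x : ℝ => x⁻¹) _)

end LogShiftedPower

section Xi

variable {ω K₄ L ρ₁ ρ₂ : ℝ} {γ β : ℝ → ℝ}

lemma xiFn_eventuallyEq : (fun x => (ω * x ^ (-1 : ℝ) + γ x) * Real.log (L * x ^ (ρ₂ - ρ₁) - K₄)
      + L ^ 2 / 2 * (β x * x ^ (2 * ρ₂ - 1))) =ᶠ[𝓝[>] 0] xiFn ω K₄ L ρ₁ ρ₂ γ β := by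
  filter_upwards [self_mem_nhdsWithin] with x hx
  have hx' : x ≠ 0 := ne_of_gt hx
  rw [xiFn, Real.rpow_neg_one]
  field_simp

lemma symbolBound_inv_add (hγ : ContDiffAt ℝ (⊤ : ℕ∞) γ 0) (k : ℕ) :
    SymbolBound k (fun x => ω * x ^ (-1 : ℝ) + γ x) (fun x => x ^ (-1 : ℝ)) :=
  ((SymbolBound.rpow (-1)).const_mul ω).add ((SymbolBound.of_contDiffAt hγ).weight_mono
    (by simpa using rpow_isBigO_rpow_nhdsGT (p := 0) (q := -1) (by norm_num)))

lemma symbolBound_mul_rpow (hρ₂ : 0 < ρ₂) (hβ : ContDiffAt ℝ (⊤ : ℕ∞) β 0) (k : ℕ) :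
    SymbolBound k (fun x => L ^ 2 / 2 * (β x * x ^ (2 * ρ₂ - 1))) (fun x => x ^ (-1 : ℝ)) := by
  refine (((SymbolBound.of_contDiffAt hβ).mul (SymbolBound.rpow _)).const_mul _).weight_mono ?_
  simpa using rpow_isBigO_rpow_nhdsGT (p := 2 * ρ₂ - 1) (q := -1) (by linarith)

lemma symbolBound_xiFn (hK₄ : 0 ≤ K₄) (hL : 0 < L) (hρ₂ : 0 < ρ₂) (hρ : ρ₂ < ρ₁)
    (hγ : ContDiffAt ℝ (⊤ : ℕ∞) γ 0) (hβ : ContDiffAt ℝ (⊤ : ℕ∞) β 0) (k : ℕ) :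
    SymbolBound k (xiFn ω K₄ L ρ₁ ρ₂ γ β) (fun x => x ^ (-1 : ℝ) * -Real.log x) := by
  refine SymbolBound.congr (SymbolBound.add ((symbolBound_inv_add hγ k).mul
    (symbolBound_log_shifted_rpow hL hK₄ (by linarith) k))
    ((symbolBound_mul_rpow hρ₂ hβ k).weight_mono ?_)) xiFn_eventuallyEq
  simpa using (isBigO_refl (fun x : ℝ => x ^ (-1 : ℝ)) (𝓝[>] 0)).mul one_isBigO_neg_log

lemma exists_deriv_xiFn_le (hω : 0 < ω) (hK₄ : 0 ≤ K₄) (hL : 0 < L) (hρ₂ : 0 < ρ₂) (hρ : ρ₂ < ρ₁)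
    (hγ : ContDiffAt ℝ (⊤ : ℕ∞) γ 0) (hβ : ContDiffAt ℝ (⊤ : ℕ∞) β 0) :
    ∃ c > 0, ∀ᶠ x in 𝓝[>] (0 : ℝ), deriv (xiFn ω K₄ L ρ₁ ρ₂ γ β) x ≤
      -(c * (x ^ (-1 : ℝ) * -Real.log x / x)) := by
  have hp : ρ₂ - ρ₁ < 0 := by linarith
  set F : ℝ → ℝ := fun x => ω * x ^ (-1 : ℝ) + γ x with hF
  set G : ℝ → ℝ := fun x => Real.log (L * x ^ (ρ₂ - ρ₁) - K₄) with hG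
  set B : ℝ → ℝ := fun x => L ^ 2 / 2 * (β x * x ^ (2 * ρ₂ - 1)) with hB
  have sF : SymbolBound 1 F _ := symbolBound_inv_add hγ 1
  have sG : SymbolBound 1 G _ := symbolBound_log_shifted_rpow hL hK₄ hp 1
  have sB : SymbolBound 1 B _ := symbolBound_mul_rpow hρ₂ hβ 1
  have sγ : SymbolBound 1 γ _ := SymbolBound.of_contDiffAt hγ
  have hγ' : deriv γ =O[𝓝[>] 0] fun _ => (1 : ℝ) :=
    (SymbolBound.of_contDiffAt (k := 0) (hγ.derivWithin (by simp))).isBigO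
  have hid : (fun x : ℝ => x) =o[𝓝[>] 0] fun _ => (1 : ℝ) := by
    rw [isLittleO_one_iff]
    exact tendsto_id.mono_left nhdsWithin_le_nhds
  have hinv : (fun _ : ℝ => (1 : ℝ)) =o[𝓝[>] 0] fun x => x ^ (-1 : ℝ) / x := by
    refine ((hid.mul hid).mul_isBigO
      (isBigO_refl (fun x : ℝ => x ^ (-1 : ℝ) / x) _)).congr' ?_ ?_
    · filter_upwards [self_mem_nhdsWithin] with x hx
      have hx' : x ≠ 0 := ne_of_gt hx
      rw [Real.rpow_neg_one]
      field_simp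
    · exact Eventually.of_forall fun x => by ring
  have e1 : (fun x => deriv γ x * G x) =o[𝓝[>] 0] fun x => x ^ (-1 : ℝ) * -Real.log x / x := by
    refine ((hγ'.trans_isLittleO hinv).mul_isBigO sG.isBigO).congr_right fun x => by ring
  have e2 : (fun x => F x * deriv G x + deriv B x) =o[𝓝[>] 0]
      fun x => x ^ (-1 : ℝ) * -Real.log x / x := by
    have hO : (fun x => F x * deriv G x + deriv B x) =O[𝓝[>] 0] fun x => x ^ (-1 : ℝ) / x :=
      ((sF.isBigO.mul (symbolBound_deriv_log_shifted_rpow hL hp 0).isBigO).congr_right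
        fun x => by rw [div_eq_mul_inv]).add sB.2.2.isBigO
    refine hO.trans_isLittleO ?_
    refine ((isBigO_refl (fun x : ℝ => x ^ (-1 : ℝ) / x) _).mul_isLittleO
      one_isLittleO_neg_log).congr (fun x => by ring) fun x => by ring
  have hc : 0 < ω * (-(ρ₂ - ρ₁) / 2) := by
    have : 0 < -(ρ₂ - ρ₁) / 2 := by linarith
    positivity
  refine ⟨ω * (-(ρ₂ - ρ₁) / 2) / 2, by positivity, ?_⟩
  filter_upwards [eventuallyEq_deriv_nhdsGT (xiFn_eventuallyEq (ω := ω) (K₄ := K₄) (L := L)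
      (ρ₁ := ρ₁) (ρ₂ := ρ₂) (γ := γ) (β := β)), sF.2.1, sG.2.1, sB.2.1, sγ.2.1,
    (e1.add e2).def (half_pos hc), eventually_le_log_shifted_rpow (K := K₄) hL hp,
    eventually_le_neg_log_nhdsGT 1, self_mem_nhdsWithin] with x h1 dF dG dB dγ h2 h3 h4 hx
  have hx0 : (0 : ℝ) < x := hx
  have hdF : deriv F x = -(ω * (x ^ (-1 : ℝ) / x)) + deriv γ x := by
    have := (((Real.hasDerivAt_rpow_const (p := -1) (Or.inl hx0.ne')).const_mul ω).add
      dγ.hasDerivAt).deriv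
    rw [show deriv F x = _ from this, Real.rpow_sub_one hx0.ne']
    ring
  have hd : deriv (xiFn ω K₄ L ρ₁ ρ₂ γ β) x = deriv F x * G x + F x * deriv G x + deriv B x := by
    rw [← h1]
    exact ((dF.hasDerivAt.mul dG.hasDerivAt).add dB.hasDerivAt).deriv
  have hw : 0 < x ^ (-1 : ℝ) / x := div_pos (Real.rpow_pos_of_pos hx0 _) hx0
  have hW : 0 ≤ x ^ (-1 : ℝ) * -Real.log x / x := by
    rw [mul_div_right_comm]
    exact mul_nonneg hw.le (by linarith)
  rw [Real.norm_of_nonneg hW] at h2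
  have h5 := (le_abs_self _).trans h2
  have h6 : ω * (x ^ (-1 : ℝ) / x) * (-(ρ₂ - ρ₁) / 2 * -Real.log x) ≤
      ω * (x ^ (-1 : ℝ) / x) * G x := by gcongr
  have h7 : ω * (x ^ (-1 : ℝ) / x) * (-(ρ₂ - ρ₁) / 2 * -Real.log x) =
      ω * (-(ρ₂ - ρ₁) / 2) * (x ^ (-1 : ℝ) * -Real.log x / x) := by ring
  rw [hd, hdF]
  linarith

end Xi

section InverseDerivatives

/-- The functions `φ j` with `g⁽ʲ⁾ = φ j ∘ g` whenever `g` is a local inverse of `f`. -/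
noncomputable def inverseDeriv (f : ℝ → ℝ) : ℕ → ℝ → ℝ
  | 0 => fun x => x
  | j + 1 => fun x => deriv (inverseDeriv f j) x * (deriv f x)⁻¹

variable {f m : ℝ → ℝ} {c δ y₀ T : ℝ}

lemma symbolBound_inverseDeriv
    (hf : ∀ k, SymbolBound k (deriv f) (fun x => x ^ (-1 : ℝ) * -Real.log x / x))
    (hf' : (fun x => x ^ (-1 : ℝ) * -Real.log x / x) =O[𝓝[>] 0] deriv f) (j k : ℕ) :
    SymbolBound k (inverseDeriv f j) (fun x => x * (x / -Real.log x) ^ j) := by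
  induction j generalizing k with
  | zero => simpa [inverseDeriv] using SymbolBound.rpow (k := k) 1
  | succ j ih =>
    have hw : ∀ᶠ x in 𝓝[>] (0 : ℝ), x ^ (-1 : ℝ) * -Real.log x / x ≠ 0 := by
      filter_upwards [self_mem_nhdsWithin, eventually_le_neg_log_nhdsGT 1] with x hx hl
      have hx0 : (0 : ℝ) < x := hx
      have hl0 : 0 < -Real.log x := by linarith
      positivity
    refine ((ih (k + 1)).2.2.mul ((hf k).inv hf' hw)).weight_mono (EventuallyEq.isBigO ?_)
    filter_upwards [self_mem_nhdsWithin] with x hx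
    have hx0 : x ≠ 0 := ne_of_gt hx
    rw [Real.rpow_neg_one]
    simp only [pow_succ, div_eq_mul_inv, mul_inv, inv_inv]
    field_simp

lemma hasDerivAt_of_rightInverse (hc : 0 < c)
    (hfd : ∀ x ∈ Ioo 0 δ, DifferentiableAt ℝ f x) (hf' : ∀ x ∈ Ioo 0 δ, deriv f x ≤ -c)
    (hm : ∀ a ∈ Ioo 0 T, m a ∈ Ioo 0 δ) (hfm : ∀ a ∈ Ioo 0 T, f (m a) = y₀ + a)
    {a : ℝ} (ha : a ∈ Ioo 0 T) : HasDerivAt m (deriv f (m a))⁻¹ a := by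
  have hlow : ∀ x ∈ Ioo 0 δ, ∀ y ∈ Ioo 0 δ, x ≤ y → f y - f x ≤ -c * (y - x) :=
    (convex_Ioo 0 δ).image_sub_le_mul_sub_of_deriv_le
      (fun x hx => (hfd x hx).continuousAt.continuousWithinAt)
      (fun x hx => (hfd x (interior_subset hx)).differentiableWithinAt)
      fun x hx => hf' x (interior_subset hx)
  have hnhds : Ioo 0 T ∈ 𝓝 a := Ioo_mem_nhds ha.1 ha.2
  have hlip : ∀ b ∈ Ioo 0 T, |m b - m a| ≤ c⁻¹ * |b - a| := by
    intro b hb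
    rw [inv_mul_eq_div, le_div_iff₀ hc]
    rcases le_total (m a) (m b) with h | h
    · have := hlow _ (hm a ha) _ (hm b hb) h
      rw [hfm a ha, hfm b hb] at this
      rw [abs_of_nonneg (sub_nonneg.2 h)]
      nlinarith [neg_abs_le (b - a)]
    · have := hlow _ (hm b hb) _ (hm a ha) h
      rw [hfm a ha, hfm b hb] at this
      rw [abs_of_nonpos (sub_nonpos.2 h)]
      nlinarith [le_abs_self (b - a)]
  have hcont : ContinuousAt m a := by
    have hz : Tendsto (fun b => c⁻¹ * |b - a|) (𝓝 a) (𝓝 0) := by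
      have : ContinuousAt (fun b => c⁻¹ * |b - a|) a := by fun_prop
      simpa [ContinuousAt] using this
    rw [ContinuousAt, tendsto_iff_dist_tendsto_zero]
    refine squeeze_zero' (Eventually.of_forall fun _ => dist_nonneg) ?_ hz
    filter_upwards [hnhds] with b hb using hlip b hb
  have hne : deriv f (m a) ≠ 0 := by
    have := hf' _ (hm a ha)
    linarith
  have hfd' : HasDerivAt (fun x => f x - y₀) (deriv f (m a)) (m a) :=
    (hfd _ (hm a ha)).hasDerivAt.sub_const _
  refine hfd'.of_local_left_inverse hcont hne ?_
  filter_upwards [hnhds] with b hb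
  rw [hfm b hb]
  ring

lemma iteratedDeriv_eq_inverseDeriv (hm : ∀ a ∈ Ioo 0 T, m a ∈ Ioo 0 δ)
    (hm' : ∀ a ∈ Ioo 0 T, HasDerivAt m (deriv f (m a))⁻¹ a) {j : ℕ}
    (hd : ∀ i < j, ∀ x ∈ Ioo 0 δ, DifferentiableAt ℝ (inverseDeriv f i) x) :
    ∀ a ∈ Ioo 0 T, iteratedDeriv j m a = inverseDeriv f j (m a) := by
  induction j with
  | zero => simp [inverseDeriv]
  | succ j ih =>
    intro a ha
    have heq : iteratedDeriv j m =ᶠ[𝓝 a] inverseDeriv f j ∘ m := by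
      filter_upwards [Ioo_mem_nhds ha.1 ha.2] with b hb
      exact ih (fun i hi => hd i (by omega)) b hb
    rw [iteratedDeriv_succ, heq.deriv_eq]
    exact ((hd j (by omega) _ (hm a ha)).hasDerivAt.comp a (hm' a ha)).deriv

end InverseDerivatives

/-- A bound for `deriv g` to the right of `a` extends to `a`, even if `g` is not differentiable
there. -/
lemma abs_deriv_le_of_Ioo {g : ℝ → ℝ} {a b M : ℝ} (hab : a < b)
    (hg : ∀ x ∈ Ioo a b, DifferentiableAt ℝ g x) (hM : ∀ x ∈ Ioo a b, |deriv g x| ≤ M) :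
    |deriv g a| ≤ M := by
  by_cases hd : DifferentiableAt ℝ g a
  · have hs : Tendsto (fun x => |slope g a x|) (𝓝[>] a) (𝓝 |deriv g a|) :=
      ((hasDerivAt_iff_tendsto_slope.1 hd.hasDerivAt).mono_left
        (nhdsWithin_mono _ fun x hx => ne_of_gt hx)).abs
    refine le_of_tendsto hs ?_
    filter_upwards [Ioo_mem_nhdsGT hab] with x hx
    have hsub : Ioo a x ⊆ Ioo a b := Ioo_subset_Ioo_right hx.2.le
    obtain ⟨y, hy, hyd⟩ := exists_deriv_eq_slope g hx.1 (fun y hy => by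
      rcases eq_or_lt_of_le hy.1 with rfl | h
      · exact hd.continuousAt.continuousWithinAt
      · exact (hg y ⟨h, hy.2.trans_lt hx.2⟩).continuousAt.continuousWithinAt)
      fun y hy => (hg y (hsub hy)).differentiableWithinAt
    rw [slope_def_field, ← hyd]
    exact hM y (hsub hy)
  · rw [deriv_zero_of_not_differentiableAt hd, abs_zero]
    exact (abs_nonneg _).trans (hM ((a + b) / 2) ⟨by linarith, by linarith⟩)

end SymbolBounds

/-- With `(μ_n)` decreasing monotonically to `0`, `ξ` strictly
monotone on `(0, μ_1]`, `ξ(μ_n) ∈ 2πℤ`, and `μ(a,n) = ξ⁻¹(ξ(μ_n) + a)`: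
for each `i ∈ {1,2,3}` there are `C > 0` and `N ∈ ℕ` such that for all `n ≥ N`
and all `a ∈ [0,2π)`, `|∂_a^{(i)} μ(a,n)| ≤ C μ_n^{i+1} / (log(μ_n⁻¹))^i`. -/
theorem stmt_10
    (ω K₄ L ρ₁ ρ₂ : ℝ) (hω : 0 < ω) (hK₄ : 1 < K₄) (hL : 0 < L)
    (hsum : ρ₁ + ρ₂ = 1) (hρ₁l : 1 / 2 < ρ₁) (hρ₁u : ρ₁ < 1)
    (γ β : ℝ → ℝ) (U : Set ℝ) (hU : U ∈ nhds (0 : ℝ))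
    (hγ : ContDiffOn ℝ (⊤ : ℕ∞) γ U) (hβ : ContDiffOn ℝ (⊤ : ℕ∞) β U)
    (μseq : ℕ → ℝ) (hpos : ∀ n, 0 < μseq n) (hanti : StrictAnti μseq)
    (hlim : Tendsto μseq atTop (nhds 0))
    (hmono : StrictMonoOn (xiFn ω K₄ L ρ₁ ρ₂ γ β) (Ioc 0 (μseq 0)) ∨
             StrictAntiOn (xiFn ω K₄ L ρ₁ ρ₂ γ β) (Ioc 0 (μseq 0)))
    (hmult : ∀ n : ℕ, ∃ k : ℤ, xiFn ω K₄ L ρ₁ ρ₂ γ β (μseq n) = 2 * Real.pi * k)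
    -- μ(a, n) = ξ⁻¹(ξ(μₙ) + a)
    (μfun : ℕ → ℝ → ℝ)
    (hμfun : ∀ n : ℕ, ∀ a ∈ Ico 0 (2 * Real.pi),
      μfun n a ∈ Ioc 0 (μseq 0) ∧
      xiFn ω K₄ L ρ₁ ρ₂ γ β (μfun n a) = xiFn ω K₄ L ρ₁ ρ₂ γ β (μseq n) + a) :
    ∀ i : ℕ, 1 ≤ i → i ≤ 3 → ∃ C > (0 : ℝ), ∃ N : ℕ, ∀ n ≥ N,
      ∀ a ∈ Ico 0 (2 * Real.pi),
        |iteratedDeriv i (μfun n) a| ≤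
          C * μseq n ^ (i + 1) / (Real.log (μseq n)⁻¹) ^ i := by
  intro i hi _
  have hρ₂ : 0 < ρ₂ := by linarith
  have hρ : ρ₂ < ρ₁ := by linarith
  have hγ₀ := hγ.contDiffAt hU
  have hβ₀ := hβ.contDiffAt hU
  have hK₀ : 0 ≤ K₄ := by linarith
  set f := xiFn ω K₄ L ρ₁ ρ₂ γ β with hf
  have sf : ∀ k, SymbolBound k f _ := symbolBound_xiFn hK₀ hL hρ₂ hρ hγ₀ hβ₀
  obtain ⟨c, hc, hfc⟩ : ∃ c > 0, ∀ᶠ x in nhdsWithin (0 : ℝ) (Ioi 0), deriv f x ≤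
      -(c * (x ^ (-1 : ℝ) * -Real.log x / x)) :=
    exists_deriv_xiFn_le hω hK₀ hL hρ₂ hρ hγ₀ hβ₀
  have hfO : Asymptotics.IsBigO (nhdsWithin (0 : ℝ) (Ioi 0))
      (fun x => x ^ (-1 : ℝ) * -Real.log x / x) (deriv f) := by
    refine Asymptotics.IsBigO.of_bound c⁻¹ ?_
    filter_upwards [hfc, self_mem_nhdsWithin, eventually_le_neg_log_nhdsGT 1] with x h1 hx hl
    have hx0 : (0 : ℝ) < x := hx
    have hl0 : 0 < -Real.log x := by linarith
    have hW : 0 < x ^ (-1 : ℝ) * -Real.log x / x := by positivity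
    rw [Real.norm_of_nonneg hW.le, inv_mul_eq_div, le_div_iff₀ hc, mul_comm]
    exact le_trans (by linarith) (neg_abs_le (deriv f x) |> neg_le.1)
  have sφ : ∀ j k, SymbolBound k (inverseDeriv f j) _ :=
    symbolBound_inverseDeriv (fun k => (sf (k + 1)).2.2) hfO
  obtain ⟨C, hC, hφC⟩ := (sφ i 0).isBigO.exists_pos
  have hall : ∀ᶠ x in nhdsWithin (0 : ℝ) (Ioi 0),
      (DifferentiableAt ℝ f x ∧ deriv f x ≤ -c) ∧
      (∀ j ∈ Finset.range i, DifferentiableAt ℝ (inverseDeriv f j) x) ∧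
      |inverseDeriv f i x| ≤ C * (x * (x / -Real.log x) ^ i) ∧ 1 ≤ -Real.log x := by
    have hφd := (eventually_all_finset (Finset.range i)).2 fun j _ => (sφ j 1).2.1
    filter_upwards [(sf 1).2.1, hfc, hφd, hφC.bound, eventually_le_neg_log_nhdsGT 1,
      Ioo_mem_nhdsGT (zero_lt_one' ℝ)] with x h1 h2 h3 h4 h5 hx
    have hx0 : 0 < x := hx.1
    have hl0 : 0 < -Real.log x := by linarith
    refine ⟨⟨h1, h2.trans ?_⟩, h3, ?_, h5⟩
    · have hw : 1 ≤ x ^ (-1 : ℝ) * -Real.log x / x := by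
        rw [Real.rpow_neg_one, le_div_iff₀ hx0, inv_mul_eq_div, le_div_iff₀ hx0]
        nlinarith [hx.2]
      nlinarith
    · rwa [Real.norm_eq_abs, Real.norm_of_nonneg (by positivity)] at h4
  obtain ⟨δ, hδ, hsub⟩ := mem_nhdsGT_iff_exists_Ioo_subset.1 hall
  have hδ0 : 0 < δ := hδ
  have hfanti : StrictAntiOn f (Ioo 0 δ) := strictAntiOn_of_deriv_neg (convex_Ioo 0 δ)
    (fun x hx => (hsub hx).1.1.continuousAt.continuousWithinAt)
    fun x hx => (hsub (interior_subset hx)).1.2.trans_lt (by linarith)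
  have hanti' : StrictAntiOn f (Ioc 0 (μseq 0)) := by
    refine hmono.resolve_left fun h => ?_
    have h0 : 0 < min δ (μseq 0) := lt_min hδ0 (hpos 0)
    set d := min δ (μseq 0) with hd
    have hdδ : d ≤ δ := min_le_left _ _
    have hdμ : d ≤ μseq 0 := min_le_right _ _
    have h1 := h (a := d / 3) (b := d / 2) ⟨by linarith, by linarith⟩ ⟨by linarith, by linarith⟩
      (by linarith)
    have h2 := hfanti (a := d / 3) (b := d / 2) ⟨by linarith, by linarith⟩
      ⟨by linarith, by linarith⟩ (by linarith)
    linarith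
  obtain ⟨N, hN⟩ := eventually_atTop.1 (hlim.eventually (gt_mem_nhds hδ0))
  refine ⟨C, hC, N, fun n hn => ?_⟩
  have hnδ : μseq n < δ := hN n hn
  have hln := (hsub ⟨hpos n, hnδ⟩).2.2.2
  have hle : ∀ a ∈ Ico 0 (2 * Real.pi), μfun n a ≤ μseq n := by
    intro a ha
    refine (hanti'.le_iff_ge ⟨hpos n, hanti.antitone (Nat.zero_le n)⟩ (hμfun n a ha).1).1 ?_
    rw [(hμfun n a ha).2]
    linarith [ha.1]
  have hmem : ∀ a ∈ Ioo 0 (2 * Real.pi), μfun n a ∈ Ioo 0 δ := fun a ha =>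
    ⟨(hμfun n a (Ioo_subset_Ico_self ha)).1.1, (hle a (Ioo_subset_Ico_self ha)).trans_lt hnδ⟩
  have hm' : ∀ a ∈ Ioo 0 (2 * Real.pi), HasDerivAt (μfun n) (deriv f (μfun n a))⁻¹ a := fun a ha =>
    hasDerivAt_of_rightInverse hc (fun x hx => (hsub hx).1.1) (fun x hx => (hsub hx).1.2) hmem
      (fun b hb => (hμfun n b (Ioo_subset_Ico_self hb)).2) ha
  have hiter : ∀ j ≤ i, ∀ a ∈ Ioo 0 (2 * Real.pi),
      iteratedDeriv j (μfun n) a = inverseDeriv f j (μfun n a) := fun j hj =>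
    iteratedDeriv_eq_inverseDeriv hmem hm' fun k hk x hx =>
      (hsub hx).2.1 k (Finset.mem_range.2 (hk.trans_le hj))
  have hinterior : ∀ a ∈ Ioo 0 (2 * Real.pi), |iteratedDeriv i (μfun n) a| ≤
      C * μseq n ^ (i + 1) / (Real.log (μseq n)⁻¹) ^ i := by
    intro a ha
    have hma := hmem a ha
    have hx0 : 0 < μfun n a := hma.1
    have hxn := hle a (Ioo_subset_Ico_self ha)
    rw [hiter i le_rfl a ha, Real.log_inv]
    refine (hsub hma).2.2.1.trans ?_
    have hlog : -Real.log (μseq n) ≤ -Real.log (μfun n a) := neg_le_neg (Real.log_le_log hx0 hxn)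
    have hl0 : 0 < -Real.log (μseq n) := by linarith
    calc C * (μfun n a * (μfun n a / -Real.log (μfun n a)) ^ i)
        ≤ C * (μseq n * (μseq n / -Real.log (μseq n)) ^ i) := by
          have := hpos n
          have := div_nonneg hx0.le (hl0.le.trans hlog)
          gcongr
      _ = _ := by rw [div_pow, pow_succ]; ring
  intro a ha
  rcases eq_or_lt_of_le ha.1 with rfl | h0
  · obtain ⟨j, rfl⟩ : ∃ j, i = j + 1 := ⟨i - 1, by omega⟩
    rw [iteratedDeriv_succ] at hinterior ⊢
    refine abs_deriv_le_of_Ioo ha.2 (fun x hx => ?_) hinterior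
    have heq : iteratedDeriv j (μfun n) =ᶠ[nhds x] inverseDeriv f j ∘ μfun n := by
      filter_upwards [Ioo_mem_nhds hx.1 hx.2] with b hb using hiter j (by omega) b hb
    exact (((hsub (hmem x hx)).2.1 j (by simp)).comp x
      (hm' x hx).differentiableAt).congr_of_eventuallyEq heq
  · exact hinterior a ⟨h0, ha.2⟩
end
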